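/- Let X and Y be complex Banach spaces with X* having the bounded approximation property, and let P : 𝓐(X) → Y be a continuous n-homogeneous polynomial. If P is orthogonally additive on the finite-rank operators (i.e. P(S+T) = P(S)+P(T) whenever S, T ∈ 𝓕(X) satisfy ST = TS = 0), then P is orthogonally additive on all of 𝓐(X). -/

import Mathlib

open Filter Topology

/-- The algebra `𝓕(X)` of finite-rank bounded operators on `X`, as a
submodule of `X →L[ℂ] X` (it is moreover a two-sided ideal of `𝓑(X)`). -/
noncomputable def FinRankOps (X : Type*) [NormedAddCommGroup X] [NormedSpace ℂ X] :
    Submodule ℂ (X →L[ℂ] X) where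
  carrier := {T | FiniteDimensional ℂ (LinearMap.range (T : X →ₗ[ℂ] X))}
  add_mem' := by
    intro a b ha hb
    have h : LinearMap.range ((a + b : X →L[ℂ] X) : X →ₗ[ℂ] X) ≤
        LinearMap.range ((a : X →L[ℂ] X) : X →ₗ[ℂ] X) ⊔
        LinearMap.range ((b : X →L[ℂ] X) : X →ₗ[ℂ] X) := by
      rintro x ⟨y, rfl⟩
      exact Submodule.mem_sup.2 ⟨a y, ⟨y, rfl⟩, b y, ⟨y, rfl⟩, by simp⟩
    haveI : FiniteDimensional ℂ (LinearMap.range ((a : X →L[ℂ] X) : X →ₗ[ℂ] X)) := ha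
    haveI : FiniteDimensional ℂ (LinearMap.range ((b : X →L[ℂ] X) : X →ₗ[ℂ] X)) := hb
    exact Submodule.finiteDimensional_of_le h
  zero_mem' := by
    simp only [Set.mem_setOf_eq]
    rw [show ((0 : X →L[ℂ] X) : X →ₗ[ℂ] X) = 0 from rfl, LinearMap.range_zero]
    infer_instance
  smul_mem' := by
    intro c a ha
    have h : LinearMap.range ((c • a : X →L[ℂ] X) : X →ₗ[ℂ] X) ≤
        LinearMap.range ((a : X →L[ℂ] X) : X →ₗ[ℂ] X) := by
      rintro x ⟨y, rfl⟩
      exact ⟨c • y, by simp⟩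
    haveI : FiniteDimensional ℂ (LinearMap.range ((a : X →L[ℂ] X) : X →ₗ[ℂ] X)) := ha
    exact Submodule.finiteDimensional_of_le h

/-- The algebra `𝓐(X)` of approximable operators on `X`: the operator-norm
closure of the finite-rank operators. -/
noncomputable def ApproxOps (X : Type*) [NormedAddCommGroup X] [NormedSpace ℂ X] :
    Submodule ℂ (X →L[ℂ] X) := (FinRankOps X).topologicalClosure

/-- `X*` has the bounded approximation property. -/
def DualHasBAP (X : Type*) [NormedAddCommGroup X] [NormedSpace ℂ X] : Prop :=
  ∃ C : ℝ, 0 < C ∧ ∀ (F : Finset (X →L[ℂ] ℂ)) (ε : ℝ), 0 < ε →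
    ∃ S : (X →L[ℂ] ℂ) →L[ℂ] (X →L[ℂ] ℂ),
      FiniteDimensional ℂ (LinearMap.range (S : (X →L[ℂ] ℂ) →ₗ[ℂ] (X →L[ℂ] ℂ))) ∧
      ‖S‖ ≤ C ∧ ∀ f ∈ F, ‖S f - f‖ < ε

section Matrices

variable {ι : Type*} [Fintype ι] [DecidableEq ι] {n : ℕ}
  {A Y : Type*} [NormedAddCommGroup A] [NormedSpace ℂ A] [NormedAddCommGroup Y] [NormedSpace ℂ Y]

theorem ContinuousMultilinearMap.hasDerivAt_diag
    (φ : ContinuousMultilinearMap ℂ (fun _ : Fin n => A) Y) {f : ℂ → A} {f' : A} {z : ℂ}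
    (hf : HasDerivAt f f' z) :
    HasDerivAt (fun s => φ (fun _ => f s))
      (φ.linearDeriv (fun _ => f z) (fun _ => f')) z :=
  (φ.hasFDerivAt (fun _ => f z)).comp_hasDerivAt z (hasDerivAt_pi.2 fun _ => hf)

theorem ContinuousMultilinearMap.norm_linearDeriv_diag_le
    (φ : ContinuousMultilinearMap ℂ (fun _ : Fin n => A) Y) {a b : A} {C : ℝ} (ha : ‖a‖ ≤ C) :
    ‖φ.linearDeriv (fun _ => a) (fun _ => b)‖ ≤ n * ‖φ‖ * C ^ (n - 1) * ‖b‖ := by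
  rw [ContinuousMultilinearMap.linearDeriv_apply]
  have key : ∀ i : Fin n, ‖φ (Function.update (fun _ => a) i b)‖ ≤ ‖φ‖ * (‖b‖ * C ^ (n - 1)) := by
    intro i
    refine (φ.le_opNorm _).trans (mul_le_mul_of_nonneg_left ?_ (norm_nonneg _))
    rw [← Finset.mul_prod_erase _ _ (Finset.mem_univ i), Function.update_self]
    refine mul_le_mul_of_nonneg_left ?_ (norm_nonneg _)
    calc ∏ j ∈ Finset.univ.erase i, ‖Function.update (fun _ => a) i b j‖
        = ∏ j ∈ Finset.univ.erase i, ‖a‖ := Finset.prod_congr rfl fun j hj => by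
          rw [Function.update_of_ne (Finset.ne_of_mem_erase hj)]
      _ = ‖a‖ ^ (n - 1) := by simp
      _ ≤ C ^ (n - 1) := pow_le_pow_left₀ (norm_nonneg _) ha _
  calc _ ≤ ∑ i : Fin n, ‖φ (Function.update (fun _ => a) i b)‖ := norm_sum_le _ _
    _ ≤ ∑ i : Fin n, ‖φ‖ * (‖b‖ * C ^ (n - 1)) := Finset.sum_le_sum fun i _ => key i
    _ = _ := by simp; ring

theorem ContinuousMultilinearMap.map_diag_smul
    (φ : ContinuousMultilinearMap ℂ (fun _ : Fin n => A) Y) (c : ℂ) (a : A) :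
    φ (fun _ => c • a) = c ^ n • φ (fun _ => a) := by
  simpa using φ.map_smul_univ (fun _ => c) (fun _ => a)

/-- On a commutative algebra `ℂ^ι`, an orthogonally additive homogeneous polynomial is a weighted
sum of powers. -/
theorem ContinuousMultilinearMap.diag_pi_eq_sum (hn : 0 < n)
    (φ : ContinuousMultilinearMap ℂ (fun _ : Fin n => A) Y) (θ : (ι → ℂ) →ₗ[ℂ] A)
    (h : ∀ μ ν : ι → ℂ, μ * ν = 0 →
      φ (fun _ => θ (μ + ν)) = φ (fun _ => θ μ) + φ (fun _ => θ ν)) (μ : ι → ℂ) :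
    φ (fun _ => θ μ) = ∑ i, μ i ^ n • φ (fun _ => θ (Pi.single i 1)) := by
  have h0 : φ (fun _ => θ 0) = 0 := by
    simpa [hn.ne'] using φ.map_diag_smul 0 (θ 0)
  have hs : ∀ s : Finset ι, φ (fun _ => θ (∑ i ∈ s, Pi.single i (μ i)))
      = ∑ i ∈ s, φ (fun _ => θ (Pi.single i (μ i))) := by
    intro s
    induction s using Finset.induction_on with
    | empty => simpa using h0
    | insert a s ha ih =>
      rw [Finset.sum_insert ha, Finset.sum_insert ha, h, ih]
      rw [Finset.mul_sum]
      refine Finset.sum_eq_zero fun i hi => ?_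
      have : a ≠ i := fun e => ha (e ▸ hi)
      ext j
      by_cases hj : j = a
      · subst hj; simp [this]
      · simp [hj]
  have := hs Finset.univ
  rw [Finset.univ_sum_single] at this
  rw [this]
  refine Finset.sum_congr rfl fun i _ => ?_
  rw [← φ.map_diag_smul, ← map_smul]
  congr! 3
  ext j
  by_cases hj : j = i
  · subst hj; simp
  · simp [hj]

/-- The derivative of an orthogonally additive polynomial at the identity recovers the polynomial
on Hermitian matrices. -/
theorem ContinuousMultilinearMap.nsmul_diag_of_isHermitian (hn : 0 < n)
    (φ : ContinuousMultilinearMap ℂ (fun _ : Fin n => A) Y) (θ : Matrix ι ι ℂ →ₗ[ℂ] A)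
    (h : ∀ M N : Matrix ι ι ℂ, M * N = 0 → N * M = 0 →
      φ (fun _ => θ (M + N)) = φ (fun _ => θ M) + φ (fun _ => θ N))
    {M : Matrix ι ι ℂ} (hM : M.IsHermitian) :
    n • φ (fun _ => θ M) = φ.linearDeriv (fun _ => θ 1) (fun _ => θ (M ^ n)) := by
  obtain ⟨δ, l, rfl⟩ : ∃ (δ : (ι → ℂ) →ₐ[ℂ] Matrix ι ι ℂ) (l : ι → ℂ), M = δ l :=
    ⟨((Unitary.conjStarAlgAut ℂ (Matrix ι ι ℂ) hM.eigenvectorUnitary).toAlgEquiv.toAlgHom).comp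
      (Matrix.diagonalAlgHom ℂ), _, hM.spectral_theorem⟩
  have hsum := φ.diag_pi_eq_sum hn (θ ∘ₗ δ.toLinearMap) (fun μ ν hμν => by
    have := h (δ μ) (δ ν) (by rw [← map_mul, hμν]; exact _root_.map_zero δ)
      (by rw [← map_mul, mul_comm, hμν]; exact _root_.map_zero δ)
    simpa using this)
  simp only [LinearMap.comp_apply, AlgHom.toLinearMap_apply] at hsum
  have hd1 : HasDerivAt (fun s : ℂ => φ (fun _ => θ (1 + s • δ l ^ n)))
      (φ.linearDeriv (fun _ => θ 1) (fun _ => θ (δ l ^ n))) 0 := by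
    have : HasDerivAt (fun s : ℂ => θ (1 + s • δ l ^ n)) (θ (δ l ^ n)) 0 := by
      simp only [map_add, map_smul]
      simpa using ((hasDerivAt_id (0 : ℂ)).smul_const (θ (δ l ^ n))).const_add (θ 1)
    simpa using φ.hasDerivAt_diag this
  have hd2 : HasDerivAt (fun s : ℂ => φ (fun _ => θ (1 + s • δ l ^ n)))
      (∑ i, (n * l i ^ n) • φ (fun _ => θ (δ (Pi.single i 1)))) 0 := by
    have e : (fun s : ℂ => φ (fun _ => θ (1 + s • δ l ^ n)))
        = fun s : ℂ => ∑ i, (1 + s * l i ^ n) ^ n • φ (fun _ => θ (δ (Pi.single i 1))) := by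
      funext s
      have := hsum (1 + s • l ^ n)
      simpa using this
    rw [e]
    refine HasDerivAt.fun_sum fun i _ => HasDerivAt.smul_const ?_ _
    have := (((hasDerivAt_id (0 : ℂ)).mul_const (l i ^ n)).const_add 1).fun_pow n
    simpa using this
  rw [hd1.unique hd2, hsum, Finset.smul_sum]
  refine Finset.sum_congr rfl fun i _ => ?_
  rw [mul_smul, Nat.cast_smul_eq_nsmul]

open scoped Matrix.Norms.Operator in
/-- The derivative of an orthogonally additive polynomial at the identity recovers the polynomial
on a full matrix algebra. -/
theorem ContinuousMultilinearMap.nsmul_diag_matrix [CompleteSpace Y] (hn : 0 < n)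
    (φ : ContinuousMultilinearMap ℂ (fun _ : Fin n => A) Y) (θ : Matrix ι ι ℂ →ₗ[ℂ] A)
    (h : ∀ M N : Matrix ι ι ℂ, M * N = 0 → N * M = 0 →
      φ (fun _ => θ (M + N)) = φ (fun _ => θ M) + φ (fun _ => θ N))
    (M : Matrix ι ι ℂ) :
    n • φ (fun _ => θ M) = φ.linearDeriv (fun _ => θ 1) (fun _ => θ (M ^ n)) := by
  let L : Matrix ι ι ℂ →L[ℂ] A := LinearMap.toContinuousLinearMap θ
  have hL : ∀ N, θ N = L N := fun N => rfl
  let a : Matrix ι ι ℂ := realPart M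
  let b : Matrix ι ι ℂ := imaginaryPart M
  have hab : a + Complex.I • b = M := realPart_add_I_smul_imaginaryPart M
  have hγ : Differentiable ℂ (fun z : ℂ => a + z • b) := by fun_prop
  have hf : Differentiable ℂ (fun z : ℂ => n • φ (fun _ => θ (a + z • b))) := by
    have : Differentiable ℂ (fun z : ℂ => φ (fun _ => θ (a + z • b))) := fun z =>
      (φ.hasDerivAt_diag ((L.hasFDerivAt.comp_hasDerivAt z
        (hγ z).hasDerivAt))).differentiableAt
    exact this.const_smul n
  have hg : Differentiable ℂ (fun z : ℂ =>
      φ.linearDeriv (fun _ => θ 1) (fun _ => θ ((a + z • b) ^ n))) := by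
    have : Differentiable ℂ (fun z : ℂ => L ((a + z • b) ^ n)) := by fun_prop
    exact (φ.linearDeriv (fun _ => θ 1)).differentiable.comp (differentiable_pi.2 fun _ => this)
  have hfg := AnalyticOnNhd.eq_of_frequently_eq (z₀ := 0) (fun z _ => hf.analyticAt z)
    (fun z _ => hg.analyticAt z) (by
      have hreal : ∀ t : ℝ, n • φ (fun _ => θ (a + (t : ℂ) • b)) =
          φ.linearDeriv (fun _ => θ 1) (fun _ => θ ((a + (t : ℂ) • b) ^ n)) := by
        intro t
        refine φ.nsmul_diag_of_isHermitian hn θ h ?_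
        have ha : IsSelfAdjoint a := (realPart M).2
        have hb : IsSelfAdjoint b := (imaginaryPart M).2
        have ht : IsSelfAdjoint (t : ℂ) := Complex.conj_ofReal t
        exact ha.add (ht.smul hb)
      have hten : Filter.Tendsto (fun k : ℕ => (((1 : ℝ) / ((k : ℝ) + 1) : ℝ) : ℂ))
          Filter.atTop (𝓝[≠] 0) := by
        refine tendsto_nhdsWithin_iff.2 ⟨?_, Filter.Eventually.of_forall fun k => ?_⟩
        · exact (Complex.continuous_ofReal.tendsto' 0 0 Complex.ofReal_zero).comp
            tendsto_one_div_add_atTop_nhds_zero_nat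
        · simp only [Set.mem_compl_iff, Set.mem_singleton_iff, Complex.ofReal_eq_zero]
          positivity
      exact hten.frequently (Filter.Frequently.of_forall fun k => hreal _))
  have := congrFun hfg Complex.I
  simpa only [hab] using this

open scoped Matrix.Norms.Operator in
/-- If `E` is a right unit for `R`, the derivative at `E` in direction `R` of an orthogonally
additive polynomial is the derivative at the identity in direction `(1 + E + ⋯ + E ^ (n - 1)) R`. -/
theorem ContinuousMultilinearMap.nsmul_linearDeriv_matrix [CompleteSpace Y] (hn : 0 < n)
    (φ : ContinuousMultilinearMap ℂ (fun _ : Fin n => A) Y) (θ : Matrix ι ι ℂ →ₗ[ℂ] A)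
    (h : ∀ M N : Matrix ι ι ℂ, M * N = 0 → N * M = 0 →
      φ (fun _ => θ (M + N)) = φ (fun _ => θ M) + φ (fun _ => θ N))
    {E R : Matrix ι ι ℂ} (hR : R * E = R) :
    n • φ.linearDeriv (fun _ => θ E) (fun _ => θ R)
      = φ.linearDeriv (fun _ => θ 1) (fun _ => θ ((∑ i ∈ Finset.range n, E ^ i) * R)) := by
  let L : Matrix ι ι ℂ →L[ℂ] A := LinearMap.toContinuousLinearMap θ
  have hγ : HasDerivAt (fun s : ℂ => E + s • R) R 0 := by
    have := ((hasDerivAt_id (0 : ℂ)).smul_const R).const_add E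
    rwa [one_smul] at this
  have hRk : ∀ k : ℕ, R * E ^ k = R := by
    intro k
    induction k with
    | zero => simp
    | succ k ih => rw [pow_succ', ← mul_assoc, hR, ih]
  have h1 : HasDerivAt (fun s : ℂ => n • φ (fun _ => θ (E + s • R)))
      (n • φ.linearDeriv (fun _ => θ E) (fun _ => θ R)) 0 := by
    have := (φ.hasDerivAt_diag (L.hasFDerivAt.comp_hasDerivAt (0 : ℂ) hγ)).const_smul n
    simpa [L] using! this
  have h2 : HasDerivAt (fun s : ℂ => n • φ (fun _ => θ (E + s • R)))
      (φ.linearDeriv (fun _ => θ 1) (fun _ => θ ((∑ i ∈ Finset.range n, E ^ i) * R))) 0 := by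
    simp only [φ.nsmul_diag_matrix hn θ h]
    have hp : HasDerivAt (fun s : ℂ => (E + s • R) ^ n) ((∑ i ∈ Finset.range n, E ^ i) * R) 0 := by
      have := hγ.pow' n
      have e : (∑ i ∈ Finset.range n, E ^ i) * R =
          ∑ i ∈ Finset.range n,
            (E + (0 : ℂ) • R) ^ (n.pred - i) * R * (E + (0 : ℂ) • R) ^ i := by
        rw [Finset.sum_mul, ← Finset.sum_range_reflect]
        refine Finset.sum_congr rfl fun i _ => ?_
        rw [zero_smul, add_zero, mul_assoc, hRk, Nat.pred_eq_sub_one]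
      rw [e]
      exact this
    have hL := L.hasFDerivAt.comp_hasDerivAt (0 : ℂ) hp
    exact (φ.linearDeriv (fun _ => θ 1)).hasFDerivAt.comp_hasDerivAt (0 : ℂ)
      (hasDerivAt_pi.2 fun _ => hL)
  exact h1.unique h2

end Matrices

section Matrices

variable {ι : Type*} [Fintype ι] [DecidableEq ι] {n : ℕ}
  {A Y : Type*} [NormedAddCommGroup A] [NormedSpace ℂ A] [NormedAddCommGroup Y] [NormedSpace ℂ Y]

theorem norm_map_pow_mul_le (θ : Matrix ι ι ℂ →ₗ[ℂ] A)
    (hθ : ∀ M N : Matrix ι ι ℂ, ‖θ (M * N)‖ ≤ ‖θ M‖ * ‖θ N‖) {E : Matrix ι ι ℂ} {C : ℝ}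
    (hE : ‖θ E‖ ≤ C) (k : ℕ) (Q : Matrix ι ι ℂ) : ‖θ (E ^ k * Q)‖ ≤ C ^ k * ‖θ Q‖ := by
  have hC : 0 ≤ C := (norm_nonneg _).trans hE
  induction k with
  | zero => simp
  | succ k ih =>
    rw [pow_succ', mul_assoc]
    calc _ ≤ ‖θ E‖ * ‖θ (E ^ k * Q)‖ := hθ _ _
      _ ≤ C * (C ^ k * ‖θ Q‖) := mul_le_mul hE ih (norm_nonneg _) hC
      _ = _ := by ring

/-- A bound for the defect of additivity of a polynomial which is orthogonally additive on a matrix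
algebra, involving the norm of a right unit `E` but not that of the identity matrix. -/
theorem ContinuousMultilinearMap.norm_diag_add_sub_le [CompleteSpace Y] (hn : 0 < n)
    (φ : ContinuousMultilinearMap ℂ (fun _ : Fin n => A) Y) (θ : Matrix ι ι ℂ →ₗ[ℂ] A)
    (hθ : ∀ M N : Matrix ι ι ℂ, ‖θ (M * N)‖ ≤ ‖θ M‖ * ‖θ N‖)
    (h : ∀ M N : Matrix ι ι ℂ, M * N = 0 → N * M = 0 →
      φ (fun _ => θ (M + N)) = φ (fun _ => θ M) + φ (fun _ => θ N))
    {C : ℝ} (hC : 1 ≤ C) {S T E : Matrix ι ι ℂ}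
    (hQE : ((S + T) ^ n - S ^ n - T ^ n) * E = (S + T) ^ n - S ^ n - T ^ n) (hE : ‖θ E‖ ≤ C) :
    ‖φ (fun _ => θ (S + T)) - φ (fun _ => θ S) - φ (fun _ => θ T)‖ ≤
      n * (n * ‖φ‖ * (C ^ n) ^ (n - 1)) * (1 + n * ((C + 1) * (n * C ^ (n * n)))) *
        ‖θ ((S + T) ^ n - S ^ n - T ^ n)‖ := by
  set Q := (S + T) ^ n - S ^ n - T ^ n with hQ
  have hn1 : (1 : ℝ) ≤ n := by exact_mod_cast hn
  set B : ℝ := n * (n * ‖φ‖ * (C ^ n) ^ (n - 1)) with hB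
  have hB0 : 0 ≤ B := by positivity
  let Λ : Matrix ι ι ℂ →ₗ[ℂ] Y :=
    (φ.linearDeriv (fun _ => θ 1)).toLinearMap ∘ₗ LinearMap.pi (fun _ => θ)
  have hΛ : ∀ M, Λ M = φ.linearDeriv (fun _ => θ 1) (fun _ => θ M) := fun M => rfl
  have hbound : ∀ F R : Matrix ι ι ℂ, ‖θ F‖ ≤ C ^ n → R * F = R →
      ‖Λ ((∑ i ∈ Finset.range n, F ^ i) * R)‖ ≤ B * ‖θ R‖ := by
    intro F R hF hR
    rw [hΛ, ← φ.nsmul_linearDeriv_matrix hn θ h hR, ← Nat.cast_smul_eq_nsmul ℝ, norm_smul,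
      Real.norm_natCast, hB, mul_assoc (n : ℝ)]
    exact mul_le_mul_of_nonneg_left (φ.norm_linearDeriv_diag_le hF) (by positivity)
  have hEn : ‖θ E‖ ≤ C ^ n := hE.trans (le_self_pow₀ hC hn.ne')
  have hEpow : ‖θ (E ^ n)‖ ≤ C ^ n := by
    obtain ⟨m, rfl⟩ : ∃ m, n = m + 1 := ⟨n - 1, by omega⟩
    rw [pow_succ, pow_succ]
    exact (norm_map_pow_mul_le θ hθ hE m E).trans
      (mul_le_mul_of_nonneg_left hE (by positivity))
  have hQk : ∀ k : ℕ, Q * E ^ k = Q := by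
    intro k
    induction k with
    | zero => simp
    | succ k ih => rw [pow_succ', ← mul_assoc, hQE, ih]
  let H : ℕ → Matrix ι ι ℂ := fun j => (∑ l ∈ Finset.range j, (E ^ n) ^ l) * Q
  have hHnorm : ∀ j ∈ Finset.range n, ‖θ (H j)‖ ≤ n * C ^ (n * n) * ‖θ Q‖ := by
    intro j hj
    have hj' : j ≤ n := (Finset.mem_range.1 hj).le
    calc ‖θ (H j)‖ = ‖∑ l ∈ Finset.range j, θ (E ^ (n * l) * Q)‖ := by
          simp only [H, Finset.sum_mul, _root_.map_sum, pow_mul]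
      _ ≤ ∑ l ∈ Finset.range j, ‖θ (E ^ (n * l) * Q)‖ := norm_sum_le _ _
      _ ≤ ∑ l ∈ Finset.range j, C ^ (n * n) * ‖θ Q‖ := by
          refine Finset.sum_le_sum fun l hl => (norm_map_pow_mul_le θ hθ hE _ _).trans ?_
          have hl' : l ≤ n := (Finset.mem_range.1 hl).le.trans hj'
          gcongr
      _ = j * C ^ (n * n) * ‖θ Q‖ := by simp; ring
      _ ≤ _ := by gcongr
  have hGnorm : ∀ j ∈ Finset.range n,
      ‖θ ((E - 1) * H j)‖ ≤ (C + 1) * (n * C ^ (n * n)) * ‖θ Q‖ := by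
    intro j hj
    rw [sub_mul, one_mul, map_sub]
    calc _ ≤ ‖θ (E * H j)‖ + ‖θ (H j)‖ := norm_sub_le _ _
      _ ≤ C * ‖θ (H j)‖ + ‖θ (H j)‖ := by
        gcongr
        exact (hθ _ _).trans (mul_le_mul_of_nonneg_right hE (norm_nonneg _))
      _ = (C + 1) * ‖θ (H j)‖ := by ring
      _ ≤ (C + 1) * (n * C ^ (n * n) * ‖θ Q‖) :=
        mul_le_mul_of_nonneg_left (hHnorm j hj) (by positivity)
      _ = _ := by ring
  have hnQ : n • Q = (∑ j ∈ Finset.range n, (E ^ n) ^ j) * Q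
      - ∑ j ∈ Finset.range n, (∑ i ∈ Finset.range n, E ^ i) * ((E - 1) * H j) := by
    have : ∀ j, (∑ i ∈ Finset.range n, E ^ i) * ((E - 1) * H j) = (E ^ n) ^ j * Q - Q := by
      intro j
      simp only [H]
      rw [← mul_assoc, ← mul_assoc, geom_sum_mul, mul_geom_sum, sub_mul, one_mul]
    simp [this, Finset.sum_mul]
  have hΛQ : ‖n • Λ Q‖ ≤ B * (1 + n * ((C + 1) * (n * C ^ (n * n)))) * ‖θ Q‖ := by
    rw [← map_nsmul, hnQ, map_sub, _root_.map_sum]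
    calc _ ≤ ‖Λ ((∑ j ∈ Finset.range n, (E ^ n) ^ j) * Q)‖
        + ∑ j ∈ Finset.range n, ‖Λ ((∑ i ∈ Finset.range n, E ^ i) * ((E - 1) * H j))‖ :=
          (norm_sub_le _ _).trans (add_le_add le_rfl (norm_sum_le _ _))
      _ ≤ B * ‖θ Q‖ + ∑ j ∈ Finset.range n, B * ((C + 1) * (n * C ^ (n * n)) * ‖θ Q‖) := by
          refine add_le_add (hbound _ _ hEpow (hQk n)) (Finset.sum_le_sum fun j hj => ?_)
          refine (hbound _ _ hEn ?_).trans (mul_le_mul_of_nonneg_left (hGnorm j hj) hB0)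
          simp only [H, mul_assoc, hQE]
      _ = _ := by simp; ring
  have hid : n • (φ (fun _ => θ (S + T)) - φ (fun _ => θ S) - φ (fun _ => θ T)) = Λ Q := by
    rw [smul_sub, smul_sub, φ.nsmul_diag_matrix hn θ h, φ.nsmul_diag_matrix hn θ h,
      φ.nsmul_diag_matrix hn θ h, ← hΛ, ← hΛ, ← hΛ, ← map_sub, ← map_sub]
  have hle : ∀ y : Y, ‖y‖ ≤ ‖n • y‖ := fun y => by
    rw [← Nat.cast_smul_eq_nsmul ℝ, norm_smul, Real.norm_natCast]
    exact le_mul_of_one_le_left (norm_nonneg _) hn1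
  exact ((hle _).trans (hid ▸ hle _)).trans hΛQ

end Matrices

theorem add_pow_of_mul_eq_zero {R : Type*} [Ring R] {s t : R} (hst : s * t = 0) (hts : t * s = 0)
    {n : ℕ} (hn : n ≠ 0) : (s + t) ^ n = s ^ n + t ^ n := by
  obtain ⟨m, rfl⟩ := Nat.exists_eq_succ_of_ne_zero hn
  clear hn
  induction m with
  | zero => simp
  | succ m ih =>
    rw [pow_succ, ih, mul_add, add_mul, add_mul, pow_succ s m, pow_succ t m, mul_assoc _ t s,
      mul_assoc _ s t, hst, hts]
    simp [pow_succ]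

section FiniteRank

variable {X : Type*} [NormedAddCommGroup X] [NormedSpace ℂ X]

theorem mem_finRankOps_iff {T : X →L[ℂ] X} :
    T ∈ FinRankOps X ↔ FiniteDimensional ℂ (LinearMap.range (T : X →ₗ[ℂ] X)) :=
  Iff.rfl

theorem mem_finRankOps_of_range_le {T : X →L[ℂ] X} (V : Submodule ℂ X) [FiniteDimensional ℂ V]
    (h : ∀ x, T x ∈ V) : T ∈ FinRankOps X := by
  have : LinearMap.range (T : X →ₗ[ℂ] X) ≤ V := by
    rintro _ ⟨x, rfl⟩
    exact h x
  exact Submodule.finiteDimensional_of_le this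

theorem mul_mem_finRankOps {S : X →L[ℂ] X} (hS : S ∈ FinRankOps X) (T : X →L[ℂ] X) :
    S * T ∈ FinRankOps X := by
  have := mem_finRankOps_iff.1 hS
  exact mem_finRankOps_of_range_le (LinearMap.range (S : X →ₗ[ℂ] X)) fun x => ⟨T x, rfl⟩

theorem exists_rightUnit {ι : Type*} [Fintype ι] (R : ι → X →L[ℂ] X)
    (hR : ∀ i, R i ∈ FinRankOps X) :
    ∃ π ∈ FinRankOps X, π * π = π ∧ ∀ i, R i * π = R i := by
  have hfd := fun i => mem_finRankOps_iff.1 (hR i)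
  let g : X →L[ℂ] (∀ i, LinearMap.range (R i : X →ₗ[ℂ] X)) :=
    ContinuousLinearMap.pi fun i => (R i).codRestrict _ fun x => ⟨x, rfl⟩
  obtain ⟨J, hJ⟩ := g.toLinearMap.rangeRestrict.exists_rightInverse_of_surjective
    (LinearMap.range_rangeRestrict _)
  let J' := LinearMap.toContinuousLinearMap J
  let g' := g.codRestrict (LinearMap.range g.toLinearMap) fun x => ⟨x, rfl⟩
  have hg : ∀ y, g' (J' y) = y := fun y => LinearMap.congr_fun hJ y
  refine ⟨J' ∘L g', mem_finRankOps_of_range_le (LinearMap.range J) fun x => ⟨g' x, rfl⟩, ?_, ?_⟩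
  · ext x
    simp [hg]
  · intro i
    ext x
    have := congrArg (fun y => ((y : ∀ i, LinearMap.range (R i : X →ₗ[ℂ] X)) i : X))
      (congrArg Subtype.val (hg (g' x)))
    exact this

theorem exists_leftUnit {ι : Type*} [Fintype ι] (R : ι → X →L[ℂ] X)
    (hR : ∀ i, R i ∈ FinRankOps X) :
    ∃ ρ ∈ FinRankOps X, ρ * ρ = ρ ∧ ∀ i, ρ * R i = R i := by
  have hfd := fun i => mem_finRankOps_iff.1 (hR i)
  let V : Submodule ℂ X := ⨆ i, LinearMap.range (R i : X →ₗ[ℂ] X)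
  obtain ⟨f, hf⟩ := Submodule.ClosedComplemented.of_finiteDimensional V
  refine ⟨V.subtypeL ∘L f, mem_finRankOps_of_range_le V fun x => (f x).2, ?_, fun i => ?_⟩
  · ext x
    simp [hf]
  · ext x
    have hx : R i x ∈ V := Submodule.mem_iSup_of_mem i ⟨x, rfl⟩
    simpa using congrArg Subtype.val (hf ⟨R i x, hx⟩)

theorem exists_unit {ι : Type*} [Fintype ι] (R : ι → X →L[ℂ] X)
    (hR : ∀ i, R i ∈ FinRankOps X) :
    ∃ p ∈ FinRankOps X, p * p = p ∧ ∀ i, p * R i = R i ∧ R i * p = R i := by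
  obtain ⟨π, hπ, hππ, hRπ⟩ := exists_rightUnit R hR
  obtain ⟨ρ, hρ, hρρ, hρR⟩ := exists_leftUnit (fun o : Option ι => o.elim π R)
    (by rintro (_ | i) <;> simp [hπ, hR])
  have hρπ : ρ * π = π := hρR none
  refine ⟨π + ρ - π * ρ, sub_mem (add_mem hπ hρ) (mul_mem_finRankOps hπ ρ), ?_, fun i => ⟨?_, ?_⟩⟩
  · simp only [mul_add, add_mul, mul_sub, sub_mul, hππ, hρρ, hρπ, mul_assoc]
    simp only [← mul_assoc, hππ, hρπ]
    abel
  · have : ρ * R i = R i := hρR (some i)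
    simp [add_mul, sub_mul, mul_assoc, this]
  · simp [mul_add, mul_sub, ← mul_assoc, hRπ]

/-- Finitely many finite-rank operators lie in a common corner `p 𝓕(X) p` isomorphic to a full
matrix algebra. -/
theorem exists_matrix_corner {ι : Type*} [Fintype ι] (R : ι → X →L[ℂ] X)
    (hR : ∀ i, R i ∈ FinRankOps X) :
    ∃ (N : ℕ) (θ : Matrix (Fin N) (Fin N) ℂ →ₗ[ℂ] X →L[ℂ] X), (∀ M, θ M ∈ FinRankOps X) ∧
      (∀ M M', θ (M * M') = θ M * θ M') ∧ Function.Injective θ ∧ ∀ i, ∃ M, θ M = R i := by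
  obtain ⟨p, hp, hpp, hpR⟩ := exists_unit R hR
  have hfd := mem_finRankOps_iff.1 hp
  let V := LinearMap.range (p : X →ₗ[ℂ] X)
  let N := Module.finrank ℂ V
  let e : V ≃L[ℂ] (Fin N → ℂ) := (Module.finBasis ℂ V).equivFun.toContinuousLinearEquiv
  let j : (Fin N → ℂ) →L[ℂ] X := V.subtypeL ∘L (e.symm : (Fin N → ℂ) →L[ℂ] V)
  let q : X →L[ℂ] (Fin N → ℂ) := (e : V →L[ℂ] (Fin N → ℂ)) ∘L p.codRestrict V fun x => ⟨x, rfl⟩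
  have hjq : ∀ x, j (q x) = p x := fun x => by simp [j, q]; rfl
  have hqj : ∀ v, q (j v) = v := fun v => by
    have hj : j v ∈ V := (e.symm v).2
    obtain ⟨x, hx⟩ := hj
    have hx' : p x = j v := hx
    have h1 : j (q (j v)) = j v := by
      rw [hjq, ← hx']
      exact congrArg (fun f : X →L[ℂ] X => f x) hpp
    have hinj : Function.Injective j := Subtype.val_injective.comp e.symm.injective
    exact hinj h1
  let θ : Matrix (Fin N) (Fin N) ℂ →ₗ[ℂ] X →L[ℂ] X :=
    { toFun := fun M => j ∘L (LinearMap.toContinuousLinearMap (Matrix.toLin' M)) ∘L q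
      map_add' := fun M M' => by ext x; simp
      map_smul' := fun c M => by ext x; simp }
  have hθ : ∀ M x, θ M x = j (Matrix.toLin' M (q x)) := fun M x => rfl
  refine ⟨N, θ, fun M => mem_finRankOps_of_range_le V fun x => (e.symm _).2, fun M M' => ?_, ?_,
    fun i => ?_⟩
  · ext x
    simp [hθ, hqj]
  · intro M M' hMM'
    refine Matrix.toLin'.injective (LinearMap.ext fun v => ?_)
    have := congrArg (fun f : X →L[ℂ] X => q (f (j v))) hMM'
    simpa only [hθ, hqj] using this
  · refine ⟨LinearMap.toMatrix' ((q ∘L R i ∘L j : (Fin N → ℂ) →L[ℂ] (Fin N → ℂ)) :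
      (Fin N → ℂ) →ₗ[ℂ] (Fin N → ℂ)), ?_⟩
    ext x
    have h1 : R i (p x) = R i x := congrArg (fun f : X →L[ℂ] X => f x) (hpR i).2
    have h2 : p (R i x) = R i x := congrArg (fun f : X →L[ℂ] X => f x) (hpR i).1
    rw [hθ, Matrix.toLin'_toMatrix']
    simp [hjq, h1, h2]

/-- A polynomial orthogonally additive on finite-rank operators is almost additive on almost
orthogonal operators, provided that finite-rank operators have uniformly bounded right units. -/
theorem exists_norm_diag_add_sub_le {A Y : Type*} [NormedAddCommGroup A] [NormedSpace ℂ A]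
    [NormedAddCommGroup Y] [NormedSpace ℂ Y] [CompleteSpace Y]
    (j : A →ₗᵢ[ℂ] X →L[ℂ] X) (hj : ∀ R ∈ FinRankOps X, R ∈ LinearMap.range j.toLinearMap)
    {C : ℝ} (hC : 1 ≤ C) (hunit : ∀ Q ∈ FinRankOps X, ∃ E ∈ FinRankOps X, ‖E‖ ≤ C ∧ Q * E = Q)
    {n : ℕ} (hn : 0 < n) (φ : ContinuousMultilinearMap ℂ (fun _ : Fin n => A) Y)
    (horth : ∀ S T : A, j S ∈ FinRankOps X → j T ∈ FinRankOps X → j S * j T = 0 → j T * j S = 0 →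
      φ (fun _ => S + T) = φ (fun _ => S) + φ (fun _ => T)) :
    ∃ K : ℝ, ∀ S T : A, j S ∈ FinRankOps X → j T ∈ FinRankOps X →
      ‖φ (fun _ => S + T) - φ (fun _ => S) - φ (fun _ => T)‖ ≤
        K * ‖(j S + j T) ^ n - j S ^ n - j T ^ n‖ := by
  refine ⟨n * (n * ‖φ‖ * (C ^ n) ^ (n - 1)) * (1 + n * ((C + 1) * (n * C ^ (n * n)))),
    fun S T hS hT => ?_⟩
  have hpow : ∀ R ∈ FinRankOps X, R ^ n ∈ FinRankOps X := fun R hR => by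
    obtain ⟨m, rfl⟩ : ∃ m, n = m + 1 := ⟨n - 1, by omega⟩
    rw [pow_succ']
    exact mul_mem_finRankOps hR _
  obtain ⟨E, hE, hEC, hQE⟩ := hunit ((j S + j T) ^ n - j S ^ n - j T ^ n)
    (sub_mem (sub_mem (hpow _ (add_mem hS hT)) (hpow _ hS)) (hpow _ hT))
  obtain ⟨N, θ, hθF, hθmul, hθinj, hθR⟩ := exists_matrix_corner ![j S, j T, E] (by
    intro i; fin_cases i <;> simp [hS, hT, hE])
  obtain ⟨MS, hMS⟩ := hθR 0
  obtain ⟨MT, hMT⟩ := hθR 1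
  obtain ⟨ME, hME⟩ := hθR 2
  simp only [Matrix.cons_val] at hMS hMT hME
  let θ' : Matrix (Fin N) (Fin N) ℂ →ₗ[ℂ] A :=
    (LinearEquiv.ofInjective j.toLinearMap j.injective).symm.toLinearMap ∘ₗ
      θ.codRestrict (LinearMap.range j.toLinearMap) fun M => hj _ (hθF M)
  have hθ' : ∀ M, j (θ' M) = θ M := fun M =>
    congrArg Subtype.val ((LinearEquiv.ofInjective j.toLinearMap j.injective).apply_symm_apply
      ⟨θ M, hj _ (hθF M)⟩)
  have hθnorm : ∀ M, ‖θ' M‖ = ‖θ M‖ := fun M => by rw [← hθ', j.norm_map]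
  have hθpow : ∀ M, θ (M ^ n) = θ M ^ n := by
    intro M
    have : ∀ m : ℕ, θ (M ^ (m + 1)) = θ M ^ (m + 1) := by
      intro m
      induction m with
      | zero => simp
      | succ m ih => rw [pow_succ, hθmul, ih, ← pow_succ]
    obtain ⟨m, rfl⟩ : ∃ m, n = m + 1 := ⟨n - 1, by omega⟩
    exact this m
  have hQ : θ ((MS + MT) ^ n - MS ^ n - MT ^ n) = (j S + j T) ^ n - j S ^ n - j T ^ n := by
    rw [map_sub, map_sub, hθpow, hθpow, hθpow, map_add, hMS, hMT]
  have hS' : θ' MS = S := j.injective ((hθ' MS).trans hMS)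
  have hT' : θ' MT = T := j.injective ((hθ' MT).trans hMT)
  have key := φ.norm_diag_add_sub_le hn θ'
    (fun M M' => by
      rw [hθnorm, hθnorm, hθnorm, hθmul]
      exact norm_mul_le _ _)
    (fun M M' h1 h2 => by
      rw [map_add]
      refine horth (θ' M) (θ' M') (by rw [hθ']; exact hθF M) (by rw [hθ']; exact hθF M') ?_ ?_
      · rw [hθ', hθ', ← hθmul, h1, map_zero]
      · rw [hθ', hθ', ← hθmul, h2, map_zero])
    hC (S := MS) (T := MT) (E := ME) (hθinj (by rw [hθmul, hQ, hME, hQE]))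
    (by rwa [hθnorm, hME])
  rwa [hθnorm, hQ, map_add, hS', hT'] at key

/-- Density argument extending orthogonal additivity from the finite-rank operators. -/
theorem diag_add_of_mul_eq_zero {A Y : Type*} [NormedAddCommGroup A] [NormedSpace ℂ A]
    [NormedAddCommGroup Y] [NormedSpace ℂ Y] [CompleteSpace Y]
    (j : A →ₗᵢ[ℂ] X →L[ℂ] X) (hj : ∀ R ∈ FinRankOps X, R ∈ LinearMap.range j.toLinearMap)
    (hdense : Dense {a | j a ∈ FinRankOps X})
    {C : ℝ} (hC : 1 ≤ C) (hunit : ∀ Q ∈ FinRankOps X, ∃ E ∈ FinRankOps X, ‖E‖ ≤ C ∧ Q * E = Q)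
    {n : ℕ} (hn : 0 < n) (φ : ContinuousMultilinearMap ℂ (fun _ : Fin n => A) Y)
    (horth : ∀ S T : A, j S ∈ FinRankOps X → j T ∈ FinRankOps X → j S * j T = 0 → j T * j S = 0 →
      φ (fun _ => S + T) = φ (fun _ => S) + φ (fun _ => T))
    (S T : A) (hST : j S * j T = 0) (hTS : j T * j S = 0) :
    φ (fun _ => S + T) = φ (fun _ => S) + φ (fun _ => T) := by
  obtain ⟨K, hK⟩ := exists_norm_diag_add_sub_le j hj hC hunit hn φ horth
  have hclosed : IsClosed {p : A × A |
      ‖φ (fun _ => p.1 + p.2) - φ (fun _ => p.1) - φ (fun _ => p.2)‖ ≤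
        K * ‖(j p.1 + j p.2) ^ n - j p.1 ^ n - j p.2 ^ n‖} := by
    have hφ := φ.cont
    have hjc := j.continuous
    refine isClosed_le ?_ ?_ <;> fun_prop
  have key : (S, T) ∈ {p : A × A |
      ‖φ (fun _ => p.1 + p.2) - φ (fun _ => p.1) - φ (fun _ => p.2)‖ ≤
        K * ‖(j p.1 + j p.2) ^ n - j p.1 ^ n - j p.2 ^ n‖} :=
    closure_minimal (fun p hp => hK p.1 p.2 hp.1 hp.2) hclosed
      ((hdense.prod hdense).closure_eq ▸ Set.mem_univ (S, T))
  change ‖φ (fun _ => S + T) - φ (fun _ => S) - φ (fun _ => T)‖ ≤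
    K * ‖(j S + j T) ^ n - j S ^ n - j T ^ n‖ at key
  rw [add_pow_of_mul_eq_zero hST hTS hn.ne', add_sub_cancel_left, sub_self, norm_zero, mul_zero,
    norm_le_zero_iff] at key
  rwa [sub_sub, sub_eq_zero] at key

end FiniteRank

section BoundedApproximation

variable {X : Type*} [NormedAddCommGroup X] [NormedSpace ℂ X]

/-- A finite set almost norming all operators that factor through a fixed finite-dimensional
space. -/
theorem exists_finite_norm_le_two_mul {F : Type*} [NormedAddCommGroup F] [NormedSpace ℂ F]
    [FiniteDimensional ℂ F] (T : X →L[ℂ] F) :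
    ∃ s : Set X, s.Finite ∧ (∀ x ∈ s, ‖x‖ ≤ 1) ∧ ∀ (E : X →L[ℂ] X) (C : ℝ),
      (∀ x, T x = 0 → E x = 0) → (∀ x ∈ s, ‖E x‖ ≤ C) → ‖E‖ ≤ 2 * C := by
  obtain ⟨J, hJ⟩ := T.toLinearMap.rangeRestrict.exists_rightInverse_of_surjective
    (LinearMap.range_rangeRestrict _)
  let J' := LinearMap.toContinuousLinearMap J
  have hTJ : ∀ v, T (J' v) = v := fun v => congrArg Subtype.val (LinearMap.congr_fun hJ v)
  set δ : ℝ := 1 / (2 * (‖J'‖ + 1)) with hδ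
  have hδ0 : 0 < δ := by positivity
  have hbdd : TotallyBounded (T '' Metric.closedBall 0 1) := by
    have : ProperSpace F := FiniteDimensional.proper ℂ F
    exact (T.lipschitz.isBounded_image
      Metric.isBounded_closedBall).isCompact_closure.totallyBounded.subset subset_closure
  obtain ⟨t, ht, htfin, hcover⟩ := Metric.finite_approx_of_totallyBounded hbdd δ hδ0
  choose r hr hTr using fun v (hv : v ∈ t) => ht hv
  refine ⟨{x | ∃ v, ∃ hv : v ∈ t, r v hv = x}, htfin.dependent_image r, ?_, fun E C hE hEC => ?_⟩
  · rintro _ ⟨v, hv, rfl⟩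
    simpa using hr v hv
  · have hball : ∀ x : X, ‖x‖ ≤ 1 → ‖E x‖ ≤ C + ‖E‖ / 2 := by
      intro x hx
      obtain ⟨v, hv, hxv⟩ := Set.mem_iUnion₂.1 (hcover ⟨x, by simpa using hx, rfl⟩)
      rw [mem_ball_iff_norm] at hxv
      set w := T.toLinearMap.rangeRestrict (x - r v hv) with hw
      have hwn : ‖w‖ < δ := by
        change ‖T (x - r v hv)‖ < δ
        rwa [map_sub, hTr]
      have h0 : E (x - r v hv - J' w) = 0 := hE _ (by
        rw [map_sub, hTJ, hw]
        exact sub_self _)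
      have hJw : ‖J' w‖ ≤ 1 / 2 :=
        calc ‖J' w‖ ≤ (‖J'‖ + 1) * δ := (J'.le_opNorm w).trans (by gcongr; linarith)
          _ = 1 / 2 := by rw [hδ]; field_simp
      have hx' : E x = E (r v hv) + E (J' w) := by
        rw [map_sub, map_sub, sub_sub, sub_eq_zero] at h0
        exact h0
      rw [hx']
      calc _ ≤ ‖E (r v hv)‖ + ‖E (J' w)‖ := norm_add_le _ _
        _ ≤ C + ‖E‖ * (1 / 2) := add_le_add (hEC _ ⟨v, hv, rfl⟩) (E.le_opNorm_of_le hJw)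
        _ = _ := by ring
    have := E.opNorm_le_of_unit_norm ((norm_nonneg _).trans (hball 0 (by simp)))
      fun x hx => hball x hx.le
    linarith

theorem exists_norm_lt_le_re (g : X →L[ℂ] ℂ) {C : ℝ} (hC : 0 ≤ C) :
    ∃ y : X, ‖y‖ < C + 1 ∧ C * ‖g‖ ≤ (g y).re := by
  rcases eq_or_ne g 0 with rfl | hg
  · exact ⟨0, by simpa using by positivity, by simp⟩
  have hg' : 0 < ‖g‖ := norm_pos_iff.2 hg
  obtain ⟨x, hx, hgx⟩ := g.exists_lt_apply_of_lt_opNorm (r := C / (C + 1) * ‖g‖)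
    (mul_lt_of_lt_one_left hg' (by rw [div_lt_one] <;> linarith))
  have hgx0 : g x ≠ 0 := norm_pos_iff.1 (lt_of_le_of_lt (by positivity) hgx)
  have hC1 : (0 : ℝ) < C + 1 := by positivity
  refine ⟨(((C + 1 : ℝ) : ℂ) * (‖g x‖ / g x)) • x, ?_, ?_⟩
  · rw [norm_smul, norm_mul, norm_div, Complex.norm_real, Complex.norm_real, norm_norm,
      div_self (norm_ne_zero_iff.2 hgx0), mul_one, Real.norm_of_nonneg hC1.le]
    exact mul_lt_of_lt_one_right hC1 hx
  · have : g ((((C + 1 : ℝ) : ℂ) * (‖g x‖ / g x)) • x) = (((C + 1) * ‖g x‖ : ℝ) : ℂ) := by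
      rw [map_smul, smul_eq_mul, mul_assoc, div_mul_cancel₀ _ hgx0]
      push_cast
      rfl
    rw [this, Complex.ofReal_re]
    calc C * ‖g‖ = (C + 1) * (C / (C + 1) * ‖g‖) := by field_simp
      _ ≤ _ := by gcongr

theorem ContinuousLinearMap.exists_eq_sum_prod_pi {ι σ E F : Type*} [Fintype ι] [Fintype σ]
    [NormedAddCommGroup E] [NormedSpace ℂ E] [NormedAddCommGroup F] [NormedSpace ℂ F]
    (Φ : (σ → E) × (ι → F) →L[ℂ] ℂ) :
    ∃ (g : σ → E →L[ℂ] ℂ) (Λ : ι → F →L[ℂ] ℂ),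
      ∀ y v, Φ (y, v) = ∑ s, g s (y s) + ∑ i, Λ i (v i) := by
  classical
  refine ⟨fun s => Φ ∘L .inl ℂ _ _ ∘L .single ℂ (fun _ : σ => E) s,
    fun i => Φ ∘L .inr ℂ _ _ ∘L .single ℂ (fun _ : ι => F) i, fun y v => ?_⟩
  have h : (y, v) = ∑ s, (Pi.single s (y s), (0 : ι → F)) +
      ∑ i, ((0 : σ → E), Pi.single i (v i)) := by
    rw [Prod.ext_iff]
    simp [Prod.fst_sum, Prod.snd_sum, Finset.univ_sum_single]
  rw [h, map_add, map_sum, map_sum]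
  rfl

theorem sum_add_sum_eq_zero_of_forall {ι κ σ : Type*} [Fintype ι] [Fintype κ] [Fintype σ]
    (w : κ → X →L[ℂ] ℂ) (Γ : κ → (X →L[ℂ] ℂ) →ₗ[ℂ] ℂ) (f : ι → X →L[ℂ] ℂ) (x : σ → X)
    (g : σ → X →L[ℂ] ℂ) (Λ : ι → (X →L[ℂ] ℂ) →L[ℂ] ℂ)
    (h : ∀ k z, ∑ s, w k (x s) * g s z + ∑ i, f i z * Λ i (w k) = 0) :
    ∑ s, (∑ k, Γ k (g s) • w k) (x s) + ∑ i, Λ i (∑ k, Γ k (f i) • w k) = 0 := by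
  have hzero : ∀ k, ∑ s, w k (x s) • g s + ∑ i, Λ i (w k) • f i = 0 := by
    intro k
    ext z
    simpa [mul_comm] using h k z
  have hsum : ∑ k, Γ k (∑ s, w k (x s) • g s + ∑ i, Λ i (w k) • f i) = 0 := by simp [hzero]
  rw [← hsum]
  simp only [map_add, map_sum, map_smul, Finset.sum_add_distrib, smul_eq_mul,
    _root_.sum_apply, _root_.smul_apply]
  rw [Finset.sum_comm, Finset.sum_comm (γ := ι)]
  simp only [mul_comm]

theorem exists_separating_functionals {ι σ E F Z : Type*} [Fintype ι] [Fintype σ]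
    [NormedAddCommGroup E] [NormedSpace ℂ E] [NormedAddCommGroup F] [NormedSpace ℂ F]
    [AddCommGroup Z] [Module ℂ Z] (A : Z →ₗ[ℂ] (σ → E) × (ι → F)) (f : ι → F) (C ε : ℝ)
    (h : ∀ z, (∀ s, ‖(A z).1 s‖ < C) → ∃ i, ε ≤ ‖(A z).2 i - f i‖) :
    ∃ (g : σ → E →L[ℂ] ℂ) (Λ : ι → F →L[ℂ] ℂ),
      (∀ z, ∑ s, g s ((A z).1 s) + ∑ i, Λ i ((A z).2 i) = 0) ∧
      ∀ (y : σ → E) (v : ι → F), (∀ s, ‖y s‖ < C) → (∀ i, ‖v i - f i‖ < ε) →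
        (∑ s, g s (y s) + ∑ i, Λ i (v i)).re < 0 := by
  let U : Set ((σ → E) × (ι → F)) :=
    (Set.univ.pi fun _ => Metric.ball 0 C) ×ˢ (Set.univ.pi fun i => Metric.ball (f i) ε)
  have hUo : IsOpen U := (isOpen_set_pi Set.finite_univ fun _ _ => Metric.isOpen_ball).prod
    (isOpen_set_pi Set.finite_univ fun _ _ => Metric.isOpen_ball)
  have hUc : Convex ℝ U := by
    refine Convex.prod (convex_pi fun s _ => ?_) (convex_pi fun i _ => ?_)
    · exact convex_ball (0 : E) C
    · exact convex_ball (f i) ε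
  have hVc : Convex ℝ (Set.range A) := by
    rw [← Set.image_univ]
    let := Module.complexToReal Z
    exact convex_univ.linear_image (A.restrictScalars ℝ)
  have hdisj : Disjoint U (Set.range A) := by
    rw [Set.disjoint_right]
    rintro _ ⟨z, rfl⟩ ⟨h1, h2⟩
    obtain ⟨i, hi⟩ := h z fun s => by simpa using h1 s (Set.mem_univ _)
    exact absurd (mem_ball_iff_norm.1 (h2 i (Set.mem_univ _))) (not_lt.2 hi)
  obtain ⟨Φ, u, hΦU, hΦV⟩ := RCLike.geometric_hahn_banach_open (𝕜 := ℂ) hUc hUo hVc hdisj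
  have hΦA : ∀ z, Φ (A z) = 0 := by
    intro z
    by_contra h0
    have := hΦV (A ((((u - 1 : ℝ) : ℂ) / Φ (A z)) • z)) ⟨_, rfl⟩
    rw [map_smul, map_smul, smul_eq_mul, div_mul_cancel₀ _ h0] at this
    simp only [RCLike.re_to_complex, Complex.ofReal_re] at this
    linarith
  have hu : u ≤ 0 := by simpa using hΦV (A 0) ⟨_, rfl⟩
  obtain ⟨g, Λ, hΦ⟩ := Φ.exists_eq_sum_prod_pi
  refine ⟨g, Λ, fun z => ?_, fun y v hy hv => ?_⟩
  · rw [← hΦ]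
    exact hΦA z
  · rw [← hΦ]
    exact (hΦU (y, v) ⟨fun s _ => by simpa using hy s,
      fun i _ => mem_ball_iff_norm.2 (hv i)⟩).trans_le hu

/-- Finite-rank operators on the dual are approximated by adjoints on finitely many vectors. -/
theorem exists_approx_adjoint {ι κ σ : Type*} [Fintype ι] [Fintype κ] [Fintype σ]
    [DecidableEq κ] (w : κ → X →L[ℂ] ℂ)
    (Γ : κ → (X →L[ℂ] ℂ) →ₗ[ℂ] ℂ) {C ε : ℝ} (hC : 0 ≤ C)
    (hS : ∀ f, ‖∑ k, Γ k f • w k‖ ≤ C * ‖f‖) (f : ι → X →L[ℂ] ℂ)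
    (hf : ∀ i, ‖∑ k, Γ k (f i) • w k - f i‖ < ε) (x : σ → X) (hx : ∀ s, ‖x s‖ ≤ 1) :
    ∃ z : κ → X, (∀ s, ‖∑ k, w k (x s) • z k‖ < C + 1) ∧
      ∀ i, ‖∑ k, f i (z k) • w k - f i‖ < ε := by
  by_contra! hcon
  let A : (κ → X) →ₗ[ℂ] (σ → X) × (ι → X →L[ℂ] ℂ) :=
    { toFun := fun z => (fun s => ∑ k, w k (x s) • z k, fun i => ∑ k, f i (z k) • w k)
      map_add' := fun z z' => by
        ext <;> simp [Finset.sum_add_distrib, add_mul]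
      map_smul' := fun c z => by
        ext
        · simp [Finset.smul_sum, smul_comm c]
        · simp [Finset.mul_sum, mul_assoc] }
  have hA : ∀ z, A z = (fun s => ∑ k, w k (x s) • z k, fun i => ∑ k, f i (z k) • w k) :=
    fun z => rfl
  obtain ⟨g, Λ, hΦA, hlt⟩ := exists_separating_functionals A f (C + 1) ε hcon
  have hid := sum_add_sum_eq_zero_of_forall w Γ f x g Λ fun k z => by
    have h1 : ∀ s, ∑ k', w k' (x s) • (Pi.single k z : κ → X) k' = w k (x s) • z := fun s =>
      (Fintype.sum_eq_single k fun b hb => by rw [Pi.single_eq_of_ne hb, smul_zero]).trans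
        (by rw [Pi.single_eq_same])
    have h2 : ∀ i, ∑ k', f i ((Pi.single k z : κ → X) k') • w k' = f i z • w k := fun i =>
      (Fintype.sum_eq_single k fun b hb => by
        rw [Pi.single_eq_of_ne hb, (f i).map_zero]
        exact zero_smul ℂ (w b)).trans (by rw [Pi.single_eq_same])
    have h := hΦA (Pi.single k z)
    simpa only [hA, h1, h2, map_smul, smul_eq_mul] using h
  choose y hy hgy using fun s => exists_norm_lt_le_re (g s) hC
  have hlt := hlt y (fun i => ∑ k, Γ k (f i) • w k) hy hf
  rw [eq_neg_of_add_eq_zero_right hid] at hlt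
  have hle : ∀ s, ((∑ k, Γ k (g s) • w k) (x s)).re ≤ (g s (y s)).re := fun s =>
    calc _ ≤ ‖(∑ k, Γ k (g s) • w k) (x s)‖ := Complex.re_le_norm _
      _ ≤ C * ‖g s‖ * 1 := (ContinuousLinearMap.le_opNorm _ _).trans
          (mul_le_mul (hS _) (hx s) (norm_nonneg _) (by positivity))
      _ ≤ _ := by simpa using hgy s
  have := Finset.sum_le_sum fun s (_ : s ∈ Finset.univ) => hle s
  simp only [Complex.add_re, Complex.neg_re, Complex.re_sum] at hlt
  linarith

theorem exists_eq_sum_smul {E F : Type*} [AddCommGroup E] [Module ℂ E] [AddCommGroup F]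
    [Module ℂ F] (S : E →ₗ[ℂ] F) [FiniteDimensional ℂ (LinearMap.range S)] :
    ∃ (N : ℕ) (w : Fin N → F) (Γ : Fin N → E →ₗ[ℂ] ℂ), ∀ g, S g = ∑ k, Γ k g • w k := by
  let b := Module.finBasis ℂ (LinearMap.range S)
  refine ⟨_, fun k => b k, fun k => b.coord k ∘ₗ S.rangeRestrict, fun g => ?_⟩
  have := congrArg Subtype.val (b.sum_repr (S.rangeRestrict g))
  rw [Submodule.coe_sum] at this
  exact this.symm

theorem DualHasBAP.exists_approx (h : DualHasBAP X) :
    ∃ C : ℝ, 0 ≤ C ∧ ∀ {ι : Type} [Fintype ι] (f : ι → X →L[ℂ] ℂ) (ε : ℝ), 0 < ε →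
      ∃ E ∈ FinRankOps X, ‖E‖ ≤ C ∧ ∀ i, ‖f i ∘L E - f i‖ < ε := by
  classical
  obtain ⟨C, hC, hS⟩ := h
  refine ⟨2 * (C + 1), by positivity, fun {ι} _ f ε hε => ?_⟩
  obtain ⟨S, hfd, hSC, hSf⟩ := hS (Finset.univ.image f) ε hε
  obtain ⟨N, w, Γ, hSum⟩ := exists_eq_sum_smul (S : (X →L[ℂ] ℂ) →ₗ[ℂ] (X →L[ℂ] ℂ))
  replace hSum : ∀ g, ∑ k, Γ k g • w k = S g := fun g => (hSum g).symm
  obtain ⟨s, hsfin, hs1, hs⟩ := exists_finite_norm_le_two_mul (ContinuousLinearMap.pi w)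
  have := hsfin.fintype
  obtain ⟨z, hz, hzf⟩ := exists_approx_adjoint w Γ hC.le
    (fun g => by rw [hSum]; exact S.le_of_opNorm_le hSC g) f
    (fun i => by rw [hSum]; exact hSf _ (Finset.mem_image_of_mem _ (Finset.mem_univ i)))
    (fun x : s => (x : X)) (fun x => hs1 x x.2)
  let E : X →L[ℂ] X := ∑ k, (w k).smulRight (z k)
  have hE : ∀ x, E x = ∑ k, w k x • z k := fun x => by simp [E]
  have hspan := FiniteDimensional.span_of_finite ℂ (Set.finite_range z)
  refine ⟨E, mem_finRankOps_of_range_le (Submodule.span ℂ (Set.range z)) fun x => ?_,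
    hs E (C + 1) (fun x hx => ?_) (fun x hx => ?_), fun i => ?_⟩
  · rw [hE]
    exact sum_mem fun k _ => Submodule.smul_mem _ _ (Submodule.subset_span ⟨k, rfl⟩)
  · rw [hE]
    refine Finset.sum_eq_zero fun k _ => ?_
    rw [show w k x = 0 from congrFun hx k, zero_smul]
  · rw [hE]
    exact (hz ⟨x, hx⟩).le
  · have : f i ∘L E = ∑ k, f i (z k) • w k := by
      ext x
      simp [hE, mul_comm]
    rw [this]
    exact hzf i

/-- If `X*` has the bounded approximation property, then finite-rank operators have uniformly
bounded finite-rank right units. -/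
theorem DualHasBAP.exists_rightUnit (h : DualHasBAP X) :
    ∃ C : ℝ, 1 ≤ C ∧ ∀ Q ∈ FinRankOps X, ∃ E ∈ FinRankOps X, ‖E‖ ≤ C ∧ Q * E = Q := by
  obtain ⟨C, hC, happ⟩ := h.exists_approx
  refine ⟨C + 1, by linarith, fun Q hQ => ?_⟩
  have hfd := mem_finRankOps_iff.1 hQ
  let V := LinearMap.range (Q : X →ₗ[ℂ] X)
  let b := Module.finBasis ℂ V
  let f : Fin (Module.finrank ℂ V) → X →L[ℂ] ℂ := fun i =>
    LinearMap.toContinuousLinearMap (b.coord i) ∘L Q.codRestrict V fun x => ⟨x, rfl⟩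
  have hQf : ∀ x, Q x = ∑ i, f i x • (b i : X) := fun x => by
    have := congrArg Subtype.val (b.sum_repr ⟨Q x, ⟨x, rfl⟩⟩)
    rw [Submodule.coe_sum] at this
    exact this.symm
  choose y hy using fun i => (b i).2
  have hy : ∀ i, Q (y i) = b i := hy
  set M : ℝ := ∑ i, ‖y i‖ with hM
  have hM0 : 0 ≤ M := Finset.sum_nonneg fun i _ => norm_nonneg _
  obtain ⟨E, hE, hEC, hEf⟩ := happ f (1 / (M + 1)) (by positivity)
  let D : X →L[ℂ] X := ∑ i, (f i ∘L E - f i).smulRight (y i)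
  refine ⟨E - D, sub_mem hE (sum_mem fun i _ => ?_), ?_, ?_⟩
  · exact mem_finRankOps_of_range_le (Submodule.span ℂ {y i}) fun x =>
      Submodule.smul_mem _ _ (Submodule.mem_span_singleton_self _)
  · refine (norm_sub_le _ _).trans (add_le_add hEC ?_)
    calc ‖D‖ ≤ ∑ i, ‖(f i ∘L E - f i).smulRight (y i)‖ := norm_sum_le _ _
      _ ≤ ∑ i, 1 / (M + 1) * ‖y i‖ := Finset.sum_le_sum fun i _ => by
          rw [ContinuousLinearMap.norm_smulRight_apply]
          exact mul_le_mul_of_nonneg_right (hEf i).le (norm_nonneg _)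
      _ = M / (M + 1) := by rw [← Finset.mul_sum, ← hM]; ring
      _ ≤ 1 := by rw [div_le_one (by positivity)]; linarith
  · ext x
    have hD : Q (D x) = Q (E x) - Q x := by
      simp only [D, _root_.sum_apply, ContinuousLinearMap.smulRight_apply, map_sum,
        map_smul, hy]
      rw [hQf (E x), hQf x, ← Finset.sum_sub_distrib]
      simp only [← sub_smul]
      rfl
    change Q (E x - D x) = Q x
    rw [map_sub, hD, sub_sub_cancel]

end BoundedApproximation

/-- if `X*` has the bounded approximation property and a
continuous `n`-homogeneous polynomial `P` on `𝓐(X)` is orthogonally additive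
on the finite-rank operators, then `P` is orthogonally additive on all of
`𝓐(X)`. -/
theorem stmt16 {X Y : Type*} [NormedAddCommGroup X] [NormedSpace ℂ X] [CompleteSpace X]
    [NormedAddCommGroup Y] [NormedSpace ℂ Y] [CompleteSpace Y]
    (hBAP : DualHasBAP X)
    (n : ℕ) (hn : 0 < n)
    (P : ↥(ApproxOps X) → Y)
    (φ : ContinuousMultilinearMap ℂ (fun _ : Fin n => ↥(ApproxOps X)) Y)
    (hP : ∀ T, P T = φ (fun _ => T))
    (horthF : ∀ S T : ↥(ApproxOps X),
      (S : X →L[ℂ] X) ∈ FinRankOps X → (T : X →L[ℂ] X) ∈ FinRankOps X →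
      (S : X →L[ℂ] X) * (T : X →L[ℂ] X) = 0 → (T : X →L[ℂ] X) * (S : X →L[ℂ] X) = 0 →
      P (S + T) = P S + P T) :
    ∀ S T : ↥(ApproxOps X),
      (S : X →L[ℂ] X) * (T : X →L[ℂ] X) = 0 → (T : X →L[ℂ] X) * (S : X →L[ℂ] X) = 0 →
      P (S + T) = P S + P T := by
  obtain ⟨C, hC, hunit⟩ := hBAP.exists_rightUnit
  intro S T hST hTS
  rw [hP, hP, hP]
  refine diag_add_of_mul_eq_zero (A := ↥(ApproxOps X)) (ApproxOps X).subtypeₗᵢ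
    (fun R hR => ⟨⟨R, (FinRankOps X).le_topologicalClosure hR⟩, rfl⟩) ?_ hC hunit hn φ
    (fun S T hS hT h1 h2 => ?_) S T hST hTS
  · rw [Subtype.dense_iff]
    intro R hR
    refine closure_mono ?_ hR
    exact fun R hR => ⟨⟨R, (FinRankOps X).le_topologicalClosure hR⟩, hR, rfl⟩
  · rw [← hP, ← hP, ← hP]
    exact horthF S T hS hT h1 h2
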